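/- Let k be a field, let r ≥ 3 be an integer, let 𝔭_n ⊂ R = k[x,y,z] be the kernel of the k-algebra homomorphism R → k[t] sending x, y, z to t³, t⁴, t⁵, and let 𝔭_m be the kernel of the k-algebra homomorphism R → k[t] sending x, y, z to t³, t⁴, t^{3r}. Then the ideal I = 𝔭_n ∩ 𝔭_m is minimally generated by the four polynomials f₁ = x⁴ − y³, f₂ = −x^{r+1}z + x^r y² + xz² − y²z, f₃ = −x^{r+3} + x^r yz + x³z − yz², f₄ = −x^{r+2}y + x^r z² + x²yz − z³, and rt(I) = 3. -/

import Mathlib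

open Polynomial MvPolynomial

/-- The kernel of the graded presentation `R[t₁,…,t_s] → 𝐑(I) ⊆ R[X]` of the Rees algebra
of the ideal generated by `f`, sending `tᵢ` to `(f i)·X`. -/
noncomputable def reesKer {R : Type*} [CommRing R] {s : ℕ} (f : Fin s → R) :
    Ideal (MvPolynomial (Fin s) R) :=
  RingHom.ker (MvPolynomial.aeval
    (fun i => Polynomial.C (f i) * Polynomial.X) : MvPolynomial (Fin s) R →ₐ[R] Polynomial R)

/-- `L` is generated by its homogeneous elements of degree at most `N`. -/
def GenInDegLE {R : Type*} [CommRing R] {s : ℕ}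
    (L : Ideal (MvPolynomial (Fin s) R)) (N : ℕ) : Prop :=
  L = Ideal.span {p | p ∈ L ∧ ∃ q ≤ N, MvPolynomial.IsHomogeneous p q}

/-- The relation type of an ideal `I`: the least `N ≥ 1` such that, for every finite
generating family of `I`, the ideal of equations of the corresponding presentation of the
Rees algebra is generated by its homogeneous elements of degree at most `N`. -/
noncomputable def relType {R : Type*} [CommRing R] (I : Ideal R) : ℕ :=
  sInf {N | 1 ≤ N ∧ ∀ (s : ℕ) (f : Fin s → R),
    Ideal.span (Set.range f) = I → GenInDegLE (reesKer f) N}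

theorem exists_pow_mul_sub_C_mem_span {B : Type*} [CommRing B] (c v : B) (e : ℕ) (Q : B[X])
    (hQ : Q.natDegree ≤ e) :
    ∃ G g : B, Polynomial.C (c ^ e) * Q - Polynomial.C G ∈
        Ideal.span {Polynomial.C c * Polynomial.X - Polynomial.C v} ∧
      G = Q.coeff e * v ^ e + c * g := by
  induction e generalizing Q with
  | zero =>
    refine ⟨Q.coeff 0, 0, ?_, by simp⟩
    rw [Polynomial.eq_C_of_natDegree_le_zero hQ]
    simp
  | succ e ih =>
    obtain ⟨G, g, hG, hg⟩ := ih Q.divX (by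
      rw [Polynomial.natDegree_divX_eq_natDegree_tsub_one]; omega)
    refine ⟨c ^ (e + 1) * Q.coeff 0 + v * G, c ^ e * Q.coeff 0 + v * g, ?_, ?_⟩
    · have h := Ideal.add_mem _ (Ideal.mul_mem_left _ (Polynomial.C c * Polynomial.X) hG)
        (Ideal.mul_mem_left _ (Polynomial.C G) (Ideal.mem_span_singleton_self
          (Polynomial.C c * Polynomial.X - Polynomial.C v)))
      convert h using 1
      simp only [map_mul, map_pow, map_add]
      linear_combination (-Polynomial.C c ^ (e + 1)) * Polynomial.divX_mul_X_add Q
    · rw [hg, Polynomial.coeff_divX]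
      ring

theorem sq_sub_C_dvd_of_dvd_mul {S : Type*} [CommRing S] [IsDomain S] (m p q : S)
    (h : p ^ 2 - q ^ 2 * m ≠ 0) (c : S[X])
    (hc : (Polynomial.X ^ 2 - Polynomial.C m) ∣
      (Polynomial.C p - Polynomial.C q * Polynomial.X) * c) :
    (Polynomial.X ^ 2 - Polynomial.C m) ∣ c := by
  have hm : (Polynomial.X ^ 2 - Polynomial.C m : S[X]).Monic :=
    Polynomial.monic_X_pow_sub_C m two_ne_zero
  have hd : (Polynomial.X ^ 2 - Polynomial.C m : S[X]).degree = 2 :=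
    Polynomial.degree_X_pow_sub_C two_pos m
  rw [← Polynomial.modByMonic_eq_zero_iff_dvd hm]
  have hr := Polynomial.modByMonic_add_div c (Polynomial.X ^ 2 - Polynomial.C m)
  have hdr := Polynomial.degree_modByMonic_lt c hm
  set ρ := c %ₘ (Polynomial.X ^ 2 - Polynomial.C m)
  rw [hd] at hdr
  have hρ : ρ = Polynomial.C (ρ.coeff 1) * Polynomial.X + Polynomial.C (ρ.coeff 0) :=
    Polynomial.eq_X_add_C_of_degree_le_one (Order.le_of_lt_succ hdr)
  set c₁ := ρ.coeff 1
  set c₀ := ρ.coeff 0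
  have h1 : (Polynomial.X ^ 2 - Polynomial.C m) ∣
      (Polynomial.C (p * c₁ - q * c₀) * Polynomial.X + Polynomial.C (p * c₀ - q * c₁ * m)) := by
    have h2 := dvd_sub hc (Dvd.intro ((Polynomial.C p - Polynomial.C q * Polynomial.X) *
      (c /ₘ (Polynomial.X ^ 2 - Polynomial.C m)) - Polynomial.C (q * c₁)) rfl)
    convert h2 using 1
    simp only [map_mul, map_sub]
    linear_combination (Polynomial.C p - Polynomial.C q * Polynomial.X) * (hr - hρ)
  have h3 := Polynomial.eq_zero_of_dvd_of_degree_lt h1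
    (by rw [hd]; exact lt_of_le_of_lt Polynomial.degree_linear_le (by decide))
  have e1 : p * c₁ - q * c₀ = 0 := by simpa using congrArg (Polynomial.coeff · 1) h3
  have e0 : p * c₀ - q * c₁ * m = 0 := by simpa using congrArg (Polynomial.coeff · 0) h3
  have z0 : c₀ = 0 := by
    refine (mul_eq_zero.1 (?_ : (p ^ 2 - q ^ 2 * m) * c₀ = 0)).resolve_left h
    linear_combination p * e0 + q * m * e1
  have z1 : c₁ = 0 := by
    refine (mul_eq_zero.1 (?_ : (p ^ 2 - q ^ 2 * m) * c₁ = 0)).resolve_left h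
    linear_combination p * e1 + q * e0
  rw [hρ, z0, z1]
  simp

theorem C_C_dvd_of_dvd_mul {R : Type*} [CommRing R] {a b : R} (hab : ∀ c, a ∣ b * c → a ∣ c)
    (Y : R[X][X])
    (h : Polynomial.C (Polynomial.C a) ∣ Polynomial.C (Polynomial.C b * Polynomial.X) * Y) :
    Polynomial.C (Polynomial.C a) ∣ Y := by
  rw [Polynomial.C_dvd_iff_dvd_coeff] at h ⊢
  intro i
  have h' := h i
  rw [Polynomial.coeff_C_mul, Polynomial.C_dvd_iff_dvd_coeff] at h'
  rw [Polynomial.C_dvd_iff_dvd_coeff]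
  intro j
  have := h' (j + 1)
  rw [mul_assoc, Polynomial.coeff_C_mul, Polynomial.coeff_X_mul] at this
  exact hab _ this

theorem dvd_of_eval_eq_zero_of_coprime {R : Type*} [CommRing R] [IsDomain R] {a b w : R}
    (ha : a ≠ 0) (hw : w ≠ 0) (hab : ∀ c, a ∣ b * c → a ∣ c) (F : R[X][X])
    (hF : Polynomial.eval₂ (Polynomial.eval₂RingHom Polynomial.C
      (Polynomial.C (w * a) * Polynomial.X)) (Polynomial.C (w * b) * Polynomial.X) F =
        (0 : R[X])) :
    (Polynomial.C (Polynomial.C a) * Polynomial.X -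
      Polynomial.C (Polynomial.C b * Polynomial.X)) ∣ F := by
  obtain ⟨G, g, hG, -⟩ := exists_pow_mul_sub_C_mem_span (Polynomial.C a)
    (Polynomial.C b * Polynomial.X) _ F le_rfl
  rw [Ideal.mem_span_singleton] at hG
  have hG0 : G = 0 := by
    obtain ⟨q, hq⟩ := hG
    have := congrArg (Polynomial.eval₂ (Polynomial.eval₂RingHom Polynomial.C
      (Polynomial.C (w * a) * Polynomial.X)) (Polynomial.C (w * b) * Polynomial.X)) hq
    simp only [Polynomial.eval₂_sub, Polynomial.eval₂_mul, hF, Polynomial.eval₂_C,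
      Polynomial.eval₂_X, Polynomial.coe_eval₂RingHom] at this
    have h0 : G.comp (Polynomial.C (w * a) * Polynomial.X) = 0 := by
      rw [Polynomial.comp]
      simp only [map_mul] at this
      have h1 : (Polynomial.C a * (Polynomial.C w * Polynomial.C b * Polynomial.X) -
        Polynomial.C b * (Polynomial.C w * Polynomial.C a * Polynomial.X) : R[X]) = 0 := by ring
      rw [h1] at this
      simpa using this
    ext n
    have h2 := congrArg (Polynomial.coeff · n) h0
    simp only [Polynomial.comp_C_mul_X_coeff, Polynomial.coeff_zero] at h2
    simpa [ha, hw] using h2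
  rw [hG0, map_zero, sub_zero] at hG
  generalize F.natDegree = e at hG
  induction e with
  | zero => simpa using hG
  | succ e ih =>
    apply ih
    obtain ⟨Y, hY⟩ := hG
    obtain ⟨Z, rfl⟩ := C_C_dvd_of_dvd_mul hab Y (by
      refine ⟨Polynomial.X * Y - Polynomial.C (Polynomial.C a ^ e) * F, ?_⟩
      have h3 : Polynomial.C (Polynomial.C a ^ (e + 1)) =
        Polynomial.C (Polynomial.C a) * Polynomial.C ((Polynomial.C a : R[X]) ^ e) := by
        rw [pow_succ', map_mul]
      rw [h3] at hY
      linear_combination hY)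
    refine ⟨Z, ?_⟩
    have hCa : (Polynomial.C (Polynomial.C a) : R[X][X]) ≠ 0 := by simpa using ha
    apply mul_left_cancel₀ hCa
    rw [← mul_assoc, ← map_mul, ← pow_succ', hY]
    ring

theorem dvd_of_dvd_mul_of_leftInverse {A S : Type*} [CommRing A] [CommRing S] [IsDomain S]
    (θ : A →+* S[X]) (η : S[X] →+* A) (hηθ : ∀ f, η (θ f) = f) {a b : A} {m p q : S}
    (ha : θ a = Polynomial.C m - Polynomial.X ^ 2)
    (hb : θ b = Polynomial.C p - Polynomial.C q * Polynomial.X)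
    (h : p ^ 2 - q ^ 2 * m ≠ 0) (c : A) (hc : a ∣ b * c) : a ∣ c := by
  have h1 := map_dvd θ hc
  rw [map_mul, ha, hb, ← neg_dvd, neg_sub] at h1
  have h2 := sq_sub_C_dvd_of_dvd_mul m p q h _ h1
  rw [← neg_dvd, neg_sub, ← ha] at h2
  simpa only [hηθ] using map_dvd η h2

theorem mem_of_coprime_of_map_eq_zero {R S : Type*} [CommRing R] [IsDomain R] [CommRing S]
    {a b w : R} (ha : a ≠ 0) (hw : w ≠ 0) (hab : ∀ c, a ∣ b * c → a ∣ c) (j : R →+* S)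
    (U V : S) (I : Ideal S)
    (hsurj : Function.Surjective ((Ideal.Quotient.mk I).comp
      (Polynomial.eval₂RingHom (Polynomial.eval₂RingHom j U) V)))
    (φ : S →+* R[X]) (hI : ∀ g ∈ I, φ g = 0) (hφj : ∀ c, φ (j c) = Polynomial.C c)
    (hU : φ U = Polynomial.C (w * a) * Polynomial.X)
    (hV : φ V = Polynomial.C (w * b) * Polynomial.X) (G : S) (hG : φ G = 0) :
    G ∈ Ideal.span {j a * V - j b * U} ⊔ I := by
  obtain ⟨F, hF⟩ := hsurj (Ideal.Quotient.mk I G)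
  rw [RingHom.comp_apply, Ideal.Quotient.mk_eq_mk_iff_sub_mem] at hF
  set τ := Polynomial.eval₂RingHom (Polynomial.eval₂RingHom j U) V with hτ
  have h : φ.comp τ = Polynomial.eval₂RingHom (Polynomial.eval₂RingHom Polynomial.C
      (Polynomial.C (w * a) * Polynomial.X)) (Polynomial.C (w * b) * Polynomial.X) := by
    refine Polynomial.ringHom_ext' (Polynomial.ringHom_ext' (RingHom.ext fun c => ?_) ?_) ?_
    · simp [hτ, hφj]
    · simp [hτ, hU]
    · simp [hτ, hV]
  have h0 : (φ.comp τ) F = 0 := by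
    have := hI _ hF
    rwa [map_sub, hG, sub_zero] at this
  rw [h] at h0
  have hd := map_dvd τ (dvd_of_eval_eq_zero_of_coprime ha hw hab F h0)
  have hm : τ F ∈ Ideal.span {j a * V - j b * U} := by
    rw [Ideal.mem_span_singleton]
    simpa [hτ] using hd
  have := Ideal.sub_mem _ (Ideal.mem_sup_left (T := I) hm) (Ideal.mem_sup_right hF)
  simpa using this

/-- Normal forms modulo relations expressing `x W` and `y W` by elements of degree `0`. -/
theorem exists_normalForm {S : Type*} [CommRing S] (x y v v' : S) (ε : S →+* S)
    (I : Ideal S) (hε : ∀ f, ∃ g₁ g₂, f - (ε f + x * g₁ + y * g₂) ∈ I)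
    (hεε : ∀ f, ε (ε f) = ε f) (J : Ideal S[X]) (hI : ∀ f ∈ I, Polynomial.C f ∈ J)
    (h₁ : Polynomial.C x * Polynomial.X - Polynomial.C v ∈ J)
    (h₂ : Polynomial.C y * Polynomial.X - Polynomial.C v' ∈ J) (n : ℕ)
    (F : S[X]) (hF : F.natDegree ≤ n) :
    ∃ (F₀ : S) (H : S[X]), H.natDegree ≤ n - 1 ∧ H.map ε = H ∧
      F - (Polynomial.C F₀ + Polynomial.X * H) ∈ J := by
  induction n generalizing F with
  | zero =>
    refine ⟨F.coeff 0, 0, by simp, by simp, ?_⟩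
    rw [Polynomial.eq_C_of_natDegree_le_zero hF]
    simp
  | succ n ih =>
    set f := F.coeff (n + 1) with hf
    obtain ⟨g₁, g₂, hg⟩ := hε f
    have hlow : (F - Polynomial.C f * Polynomial.X ^ (n + 1) +
        Polynomial.C (g₁ * v + g₂ * v') * Polynomial.X ^ n).natDegree ≤ n := by
      rw [Polynomial.natDegree_le_iff_coeff_eq_zero]
      intro N hN
      rw [Polynomial.coeff_add, Polynomial.coeff_sub, Polynomial.coeff_C_mul_X_pow,
        Polynomial.coeff_C_mul_X_pow, if_neg (show N ≠ n by omega)]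
      split_ifs with h
      · rw [h, hf]; simp
      · rw [Polynomial.coeff_eq_zero_of_natDegree_lt (show F.natDegree < N by omega)]; simp
    obtain ⟨F₀, H, hH, hHε, hJ⟩ := ih _ hlow
    refine ⟨F₀, H + Polynomial.C (ε f) * Polynomial.X ^ n, ?_, ?_, ?_⟩
    · refine (Polynomial.natDegree_add_le _ _).trans (max_le (by omega) ?_)
      exact Polynomial.natDegree_C_mul_X_pow_le _ n
    · simp [hHε, hεε]
    · have := J.add_mem hJ (J.add_mem (J.add_mem
        (J.mul_mem_left (Polynomial.C g₁ * Polynomial.X ^ n) h₁)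
        (J.mul_mem_left (Polynomial.C g₂ * Polynomial.X ^ n) h₂))
        (J.mul_mem_left (Polynomial.X ^ (n + 1)) (hI _ hg)))
      convert this using 1
      simp only [map_add, map_mul, map_sub]
      ring

/-- An evaluation of `S[W]` whose kernel meets `S` in `(p)` has kernel `J`, if `J` expresses
`x W` and `y W` by elements of `S`. -/
theorem mem_of_normalForm {S T : Type*} [CommRing S] [IsDomain S] [CommRing T]
    (x y v v' p : S) (ε : S →+* S)
    (hε : ∀ f, ∃ g₁ g₂, f = ε f + x * g₁ + y * g₂) (hεε : ∀ f, ε (ε f) = ε f)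
    (hx : ε x = 0) (hv : ε v ≠ 0) (hp : ε p = 0) (J : Ideal S[X])
    (h₁ : Polynomial.C x * Polynomial.X - Polynomial.C v ∈ J)
    (h₂ : Polynomial.C y * Polynomial.X - Polynomial.C v' ∈ J)
    (hpJ : Polynomial.C p ∈ J) (φ : S[X] →+* T) (hφ : ∀ f ∈ J, φ f = 0)
    (hker : ∀ G, φ (Polynomial.C G) = 0 → p ∣ G) (F : S[X]) (hF : φ F = 0) : F ∈ J := by
  obtain ⟨F₀, H, -, hHε, hJ⟩ := exists_normalForm x y v v' ε ⊥
    (fun f => by simpa [sub_eq_zero] using hε f) hεε J (by simp) h₁ h₂ _ F le_rfl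
  set Q := Polynomial.C F₀ + Polynomial.X * H with hQ
  have hφQ : φ Q = 0 := by
    have := hφ _ hJ
    rwa [map_sub, hF, zero_sub, neg_eq_zero] at this
  have hH : H = 0 := by
    by_contra hne
    have hdeg : Q.natDegree ≤ H.natDegree + 1 := by
      refine (Polynomial.natDegree_add_le _ _).trans (max_le (by simp) ?_)
      exact (Polynomial.natDegree_mul_le).trans
        (by have := Polynomial.natDegree_X_le (R := S); omega)
    obtain ⟨G, g, hG, hg⟩ := exists_pow_mul_sub_C_mem_span x v _ Q hdeg
    have hGJ := hφ _ ((Ideal.span_singleton_le_iff_mem _).2 h₁ hG)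
    rw [map_sub, map_mul, hφQ, mul_zero, zero_sub, neg_eq_zero] at hGJ
    obtain ⟨q, rfl⟩ := hker _ hGJ
    have hc : Q.coeff (H.natDegree + 1) = H.leadingCoeff := by
      simp [hQ]
    have hl : ε H.leadingCoeff = H.leadingCoeff := by
      simpa using congrArg (Polynomial.coeff · H.natDegree) hHε
    have := congrArg ε hg
    simp only [map_mul, map_add, map_pow, hp, hx, zero_mul, add_zero, hc, hl] at this
    exact mul_ne_zero (Polynomial.leadingCoeff_ne_zero.2 hne) (pow_ne_zero _ hv) this.symm
  rw [hQ, hH, mul_zero, add_zero] at hφQ hJ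
  obtain ⟨q, hq⟩ := hker _ hφQ
  have hq' : Polynomial.C F₀ ∈ J := by
    rw [hq, map_mul]
    exact J.mul_mem_right _ hpJ
  simpa using J.add_mem hJ hq'

/-- A variant of `mem_of_normalForm`, relative to an ideal `I` of `S`, in presence of a monic
quadratic equation for `W`. -/
theorem mem_of_normalForm_of_quadratic {S T : Type*} [CommRing S] [IsDomain S] [CommRing T]
    (x y v v' p c d V : S) (I : Ideal S) (ε ε' : S →+* S)
    (hε : ∀ f, ∃ g₁ g₂, f - (ε f + x * g₁ + y * g₂) ∈ I) (hεε : ∀ f, ε (ε f) = ε f)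
    (hε'ε : ∀ f, ε' (ε f) = ε f) (hx : ε' x = 0) (hεy : ε y = 0)
    (hI : ∀ f ∈ I, ε' f = 0) (hy0 : y ≠ 0) (hV : V ≠ 0)
    (hv : ε' v = y * V) (hp : ε' p = - y ^ 2 * V) (J : Ideal S[X])
    (hIJ : ∀ f ∈ I, Polynomial.C f ∈ J)
    (h₁ : Polynomial.C x * Polynomial.X - Polynomial.C v ∈ J)
    (h₂ : Polynomial.C y * Polynomial.X - Polynomial.C v' ∈ J)
    (hpJ : Polynomial.C p ∈ J)
    (hD : Polynomial.X ^ 2 + Polynomial.C c * Polynomial.X + Polynomial.C d ∈ J)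
    (φ : S[X] →+* T) (hφ : ∀ f ∈ J, φ f = 0)
    (hker : ∀ G, φ (Polynomial.C G) = 0 → G ∈ Ideal.span {p} ⊔ I)
    (F : S[X]) (hF : φ F = 0) : F ∈ J := by
  set D : S[X] := Polynomial.X ^ 2 + Polynomial.C c * Polynomial.X + Polynomial.C d with hDdef
  have hDm : D.Monic := by
    rw [hDdef, add_assoc]
    exact Polynomial.monic_X_pow_add (lt_of_le_of_lt Polynomial.degree_linear_le (by decide))
  have hDd : D.natDegree ≤ 2 := by
    rw [hDdef]; compute_degree
  have hmod : F - F %ₘ D ∈ J := by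
    rw [Polynomial.modByMonic_eq_sub_mul_div, sub_sub_cancel]
    exact J.mul_mem_right _ hD
  have hdeg : (F %ₘ D).natDegree ≤ 1 := by
    nontriviality S
    by_cases hD1 : D = 1
    · simp [hD1]
    · have := Polynomial.natDegree_modByMonic_lt F hDm hD1
      omega
  obtain ⟨F₀, H, hHd, hHε, hJ⟩ :=
    exists_normalForm x y v v' ε I hε hεε J hIJ h₁ h₂ 1 _ hdeg
  obtain ⟨h, rfl⟩ : ∃ h, H = Polynomial.C h := ⟨_, Polynomial.eq_C_of_natDegree_le_zero hHd⟩
  have hh : ε h = h := by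
    simpa using hHε
  have hJF := J.add_mem hmod hJ
  rw [sub_add_sub_cancel] at hJF
  have hφF := hφ _ hJF
  rw [map_sub, hF, zero_sub, neg_eq_zero] at hφF
  have hh0 : h = 0 := by
    have h3 : φ (Polynomial.C (x * F₀ + h * v)) = 0 := by
      have h4 := congrArg (φ (Polynomial.C x) * ·) hφF
      have h5 := congrArg (φ (Polynomial.C h) * ·) (hφ _ h₁)
      simp only [map_add, map_mul, map_sub, mul_zero] at h4 h5 ⊢
      linear_combination h4 - h5
    obtain ⟨s, hs, i, hi, hsi⟩ := Submodule.mem_sup.1 (hker _ h3)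
    obtain ⟨q, rfl⟩ := Ideal.mem_span_singleton.1 hs
    have h6 := congrArg ε' hsi
    have hε'h : ε' h = h := by rw [← hh, hε'ε]
    simp only [map_add, map_mul, hp, hI _ hi, hx, zero_mul, zero_add, add_zero, hv, hε'h] at h6
    have h7 : h = - (y * ε' q) := by
      apply mul_right_cancel₀ (mul_ne_zero hy0 hV)
      linear_combination -h6
    rw [← hh, h7]
    simp [hεy]
  rw [hh0, map_zero, mul_zero, add_zero] at hφF hJF
  obtain ⟨s, hs, i, hi, hsi⟩ := Submodule.mem_sup.1 (hker _ hφF)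
  obtain ⟨q, rfl⟩ := Ideal.mem_span_singleton.1 hs
  have hF₀ : Polynomial.C F₀ ∈ J := by
    rw [← hsi, map_add, map_mul]
    exact J.add_mem (J.mul_mem_right _ hpJ) (hIJ _ hi)
  simpa using J.add_mem hJF hF₀

/-- The kernel of an evaluation of `B[T]` is generated by its part `J₁` of degree zero and two
equations `w T = ℓ` and `D T = E`, if `w` and `D` generate a prime ideal modulo `J₁` which does
not contain `ℓ`. -/
theorem mem_of_residue {B T T' : Type*} [CommRing B] [CommRing T] [CommRing T'] [IsDomain T']
    (w ℓ D E : B) (Φ : B[X] →+* T) (χ : B →+* T') (J₁ : Ideal B)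
    (hΦ : ∀ G, Φ (Polynomial.C G) = 0 → G ∈ J₁) (hJ₁ : ∀ G ∈ J₁, χ G = 0) (hw : χ w = 0)
    (hℓ : χ ℓ ≠ 0) (hχ : ∀ G, χ G = 0 → G ∈ J₁ ⊔ Ideal.span {w, D}) (J : Ideal B[X])
    (hJ₁J : ∀ G ∈ J₁, Polynomial.C G ∈ J)
    (h₁ : Polynomial.C w * Polynomial.X - Polynomial.C ℓ ∈ J)
    (h₂ : Polynomial.C D * Polynomial.X - Polynomial.C E ∈ J)
    (hΦJ : ∀ F ∈ J, Φ F = 0) (F : B[X]) (hF : Φ F = 0) : F ∈ J := by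
  suffices ∀ n, ∀ F : B[X], F.natDegree ≤ n → Φ F = 0 → F ∈ J from this _ F le_rfl hF
  clear F hF
  intro n
  induction n with
  | zero =>
    intro F hd hF
    rw [Polynomial.eq_C_of_natDegree_le_zero hd] at hF ⊢
    exact hJ₁J _ (hΦ _ hF)
  | succ n ih =>
    intro F hd hF
    obtain ⟨G, g, hG, hg⟩ := exists_pow_mul_sub_C_mem_span w ℓ _ F hd
    have hGJ := hΦJ _ ((Ideal.span_singleton_le_iff_mem _).2 h₁ hG)
    rw [map_sub, map_mul, hF, mul_zero, zero_sub, neg_eq_zero] at hGJ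
    have h3 := hJ₁ _ (hΦ _ hGJ)
    rw [hg] at h3
    simp only [map_add, map_mul, map_pow, hw, zero_mul, add_zero] at h3
    have h4 := hχ _ ((mul_eq_zero.1 h3).resolve_right (pow_ne_zero _ hℓ))
    obtain ⟨s, hs, i, hi, hsi⟩ := Submodule.mem_sup.1 h4
    obtain ⟨α, β, rfl⟩ := Ideal.mem_span_pair.1 hi
    have hmem : Polynomial.C s * Polynomial.X ^ (n + 1) +
        (Polynomial.C α * Polynomial.X ^ n *
          (Polynomial.C w * Polynomial.X - Polynomial.C ℓ) +
        Polynomial.C β * Polynomial.X ^ n *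
          (Polynomial.C D * Polynomial.X - Polynomial.C E)) ∈ J :=
      J.add_mem (J.mul_mem_right _ (hJ₁J _ hs))
        (J.add_mem (J.mul_mem_left _ h₁) (J.mul_mem_left _ h₂))
    have heq : F - (Polynomial.C s * Polynomial.X ^ (n + 1) +
        (Polynomial.C α * Polynomial.X ^ n *
          (Polynomial.C w * Polynomial.X - Polynomial.C ℓ) +
        Polynomial.C β * Polynomial.X ^ n *
          (Polynomial.C D * Polynomial.X - Polynomial.C E))) =
        F - Polynomial.C (F.coeff (n + 1)) * Polynomial.X ^ (n + 1) +
          Polynomial.C (α * ℓ + β * E) * Polynomial.X ^ n := by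
      rw [← hsi]
      simp only [map_add, map_mul]
      ring
    have hlow : (F - Polynomial.C (F.coeff (n + 1)) * Polynomial.X ^ (n + 1) +
        Polynomial.C (α * ℓ + β * E) * Polynomial.X ^ n).natDegree ≤ n := by
      rw [Polynomial.natDegree_le_iff_coeff_eq_zero]
      intro N hN
      rw [Polynomial.coeff_add, Polynomial.coeff_sub, Polynomial.coeff_C_mul_X_pow,
        Polynomial.coeff_C_mul_X_pow, if_neg (show N ≠ n by omega)]
      split_ifs with h
      · rw [h]; simp
      · rw [Polynomial.coeff_eq_zero_of_natDegree_lt (show F.natDegree < N by omega)]; simp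
    have h5 := ih _ (heq ▸ hlow) (by rw [map_sub, hF, hΦJ _ hmem, sub_zero])
    simpa using J.add_mem h5 hmem

theorem MvPolynomial.map_sub_map_mem {σ R B : Type*} [CommRing R] [CommRing B]
    (φ ψ : MvPolynomial σ R →+* B) (N : Ideal B)
    (hC : ∀ c, φ (MvPolynomial.C c) - ψ (MvPolynomial.C c) ∈ N)
    (hX : ∀ i, φ (MvPolynomial.X i) - ψ (MvPolynomial.X i) ∈ N) (f : MvPolynomial σ R) :
    φ f - ψ f ∈ N := by
  have : (Ideal.Quotient.mk N).comp φ = (Ideal.Quotient.mk N).comp ψ :=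
    MvPolynomial.ringHom_ext (fun c => (Ideal.Quotient.mk_eq_mk_iff_sub_mem _ _).2 (hC c))
      (fun i => (Ideal.Quotient.mk_eq_mk_iff_sub_mem _ _).2 (hX i))
  exact (Ideal.Quotient.mk_eq_mk_iff_sub_mem _ _).1 (congrArg (· f) this)

theorem MvPolynomial.surjective_of_mem_range {σ R A Q : Type*} [CommRing R] [CommRing A]
    [CommRing Q] (q : MvPolynomial σ R →+* Q) (hq : Function.Surjective q) (φ : A →+* Q)
    (hC : ∀ c, q (MvPolynomial.C c) ∈ φ.range) (hX : ∀ i, q (MvPolynomial.X i) ∈ φ.range) :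
    Function.Surjective φ := by
  intro b
  obtain ⟨f, rfl⟩ := hq b
  change q f ∈ φ.range
  induction f using MvPolynomial.induction_on with
  | C c => exact hC c
  | add f g hf hg => rw [map_add]; exact add_mem hf hg
  | mul_X f i hf => rw [map_mul]; exact mul_mem hf (hX i)

theorem monomialCurve_coprime {k : Type*} [Field k] (c : MvPolynomial (Fin 3) k)
    (h : (X 0 * X 2 - X 1 ^ 2 : MvPolynomial (Fin 3) k) ∣ (X 0 ^ 3 - X 1 * X 2) * c) :
    (X 0 * X 2 - X 1 ^ 2 : MvPolynomial (Fin 3) k) ∣ c := by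
  let θ : MvPolynomial (Fin 3) k →+* (MvPolynomial (Fin 2) k)[X] :=
    MvPolynomial.eval₂Hom (Polynomial.C.comp MvPolynomial.C)
      ![Polynomial.C (MvPolynomial.X 0), Polynomial.X, Polynomial.C (MvPolynomial.X 1)]
  let η : (MvPolynomial (Fin 2) k)[X] →+* MvPolynomial (Fin 3) k :=
    Polynomial.eval₂RingHom (MvPolynomial.eval₂Hom MvPolynomial.C
      ![MvPolynomial.X 0, MvPolynomial.X 2]) (MvPolynomial.X 1)
  have hηθ : η.comp θ = RingHom.id _ := by
    refine MvPolynomial.ringHom_ext (fun c => by simp [η, θ]) (fun i => ?_)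
    fin_cases i <;> simp [η, θ]
  refine dvd_of_dvd_mul_of_leftInverse θ η (fun f => congrArg (· f) hηθ) (m := X 0 * X 1)
    (p := X 0 ^ 3) (q := X 1) (by simp [θ]) (by simp [θ, Polynomial.X_mul_C]) (fun h0 => ?_) c h
  simpa using congrArg (MvPolynomial.eval ![1, 0]) h0

theorem binomialPlane_coprime {k : Type*} [Field k] (ρ : ℕ) (hρ : 2 ≤ ρ)
    (c : MvPolynomial (Fin 2) k)
    (h : (X 0 ^ (ρ + 2) - X 1 ^ 2 : MvPolynomial (Fin 2) k) ∣
      (X 0 ^ 3 - X 0 ^ (ρ + 1) * X 1) * c) :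
    (X 0 ^ (ρ + 2) - X 1 ^ 2 : MvPolynomial (Fin 2) k) ∣ c := by
  let θ : MvPolynomial (Fin 2) k →+* k[X][X] :=
    MvPolynomial.eval₂Hom (Polynomial.C.comp Polynomial.C)
      ![Polynomial.C Polynomial.X, Polynomial.X]
  let η : k[X][X] →+* MvPolynomial (Fin 2) k :=
    Polynomial.eval₂RingHom (Polynomial.eval₂RingHom MvPolynomial.C (X 0)) (X 1)
  have hηθ : η.comp θ = RingHom.id _ := by
    refine MvPolynomial.ringHom_ext (fun c => by simp [η, θ]) (fun i => ?_)
    fin_cases i <;> simp [η, θ]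
  refine dvd_of_dvd_mul_of_leftInverse θ η (fun f => congrArg (· f) hηθ)
    (m := Polynomial.X ^ (ρ + 2)) (p := Polynomial.X ^ 3) (q := Polynomial.X ^ (ρ + 1))
    (by simp [θ]) (by simp [θ]) (fun h0 => ?_) c h
  have := congrArg (Polynomial.coeff · 6) h0
  simp only [← pow_mul, ← pow_add, Polynomial.coeff_sub, Polynomial.coeff_X_pow] at this
  rw [if_pos (by norm_num), if_neg (by omega)] at this
  simp at this

section Bigraded

variable (k : Type*) [Field k]

/-- The equation `z U - y V + x W`. -/
noncomputable def lin₁ : (MvPolynomial (Fin 5) k)[X] :=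
  Polynomial.C (X 0) * Polynomial.X - Polynomial.C (X 1 * X 4 - X 2 * X 3)

/-- The equation `x² U - z V + y W`. -/
noncomputable def lin₂ : (MvPolynomial (Fin 5) k)[X] :=
  Polynomial.C (X 1) * Polynomial.X - Polynomial.C (X 2 * X 4 - X 0 ^ 2 * X 3)

/-- The quadratic form `W² + x^ρ U W + x U V - x^ρ V²`. -/
noncomputable def quad (ρ : ℕ) : (MvPolynomial (Fin 5) k)[X] :=
  Polynomial.X ^ 2 + Polynomial.C (X 0 ^ ρ * X 3) * Polynomial.X +
    Polynomial.C (X 0 * X 3 * X 4 - X 0 ^ ρ * X 4 ^ 2)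

/-- The evaluation of `k[x,y,z,U,V][W]` on the Rees algebra of `w (xz - y², x³ - yz, x²y - z²)`. -/
noncomputable def spaceEval (w : MvPolynomial (Fin 3) k) :
    (MvPolynomial (Fin 5) k)[X] →+* (MvPolynomial (Fin 3) k)[X] :=
  Polynomial.eval₂RingHom (MvPolynomial.eval₂Hom (Polynomial.C.comp MvPolynomial.C)
    ![Polynomial.C (X 0), Polynomial.C (X 1), Polynomial.C (X 2),
      Polynomial.C (w * (X 0 * X 2 - X 1 ^ 2)) * Polynomial.X,
      Polynomial.C (w * (X 0 ^ 3 - X 1 * X 2)) * Polynomial.X])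
    (Polynomial.C (w * (X 0 ^ 2 * X 1 - X 2 ^ 2)) * Polynomial.X)

/-- The evaluation of `k[x,y,z,U,V][W]` on the Rees algebra of the restriction of
`(xz - y², x³ - yz, x²y - z²)` to the surface `z = x ^ (ρ + 1)`. -/
noncomputable def planeEval (ρ : ℕ) :
    (MvPolynomial (Fin 5) k)[X] →+* (MvPolynomial (Fin 2) k)[X] :=
  Polynomial.eval₂RingHom (MvPolynomial.eval₂Hom (Polynomial.C.comp MvPolynomial.C)
    ![Polynomial.C (X 0), Polynomial.C (X 1), Polynomial.C (X 0 ^ (ρ + 1)),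
      Polynomial.C (X 0 ^ (ρ + 2) - X 1 ^ 2) * Polynomial.X,
      Polynomial.C (X 0 ^ 3 - X 0 ^ (ρ + 1) * X 1) * Polynomial.X])
    (Polynomial.C (X 0 ^ 2 * X 1 - X 0 ^ (2 * ρ + 2)) * Polynomial.X)

variable {k}

@[simp] theorem spaceEval_x (w : MvPolynomial (Fin 3) k) : spaceEval k w (Polynomial.C (X 0)) =
    Polynomial.C (X 0) := by
  simp [spaceEval]

@[simp] theorem spaceEval_y (w : MvPolynomial (Fin 3) k) : spaceEval k w (Polynomial.C (X 1)) =
    Polynomial.C (X 1) := by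
  simp [spaceEval]

@[simp] theorem spaceEval_z (w : MvPolynomial (Fin 3) k) : spaceEval k w (Polynomial.C (X 2)) =
    Polynomial.C (X 2) := by
  simp [spaceEval]

@[simp] theorem spaceEval_U (w : MvPolynomial (Fin 3) k) : spaceEval k w (Polynomial.C (X 3)) =
    Polynomial.C (w * (X 0 * X 2 - X 1 ^ 2)) * Polynomial.X := by
  simp [spaceEval]

@[simp] theorem spaceEval_V (w : MvPolynomial (Fin 3) k) : spaceEval k w (Polynomial.C (X 4)) =
    Polynomial.C (w * (X 0 ^ 3 - X 1 * X 2)) * Polynomial.X := by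
  simp [spaceEval]

@[simp] theorem spaceEval_W (w : MvPolynomial (Fin 3) k) : spaceEval k w Polynomial.X =
    Polynomial.C (w * (X 0 ^ 2 * X 1 - X 2 ^ 2)) * Polynomial.X := by
  simp [spaceEval]

theorem spaceEval_eq_zero_of_mem (w : MvPolynomial (Fin 3) k) :
    ∀ F ∈ Ideal.span {lin₁ k, lin₂ k}, spaceEval k w F = 0 := by
  intro F hF
  obtain ⟨α, β, rfl⟩ := Ideal.mem_span_pair.1 hF
  have h₁ : spaceEval k w (lin₁ k) = 0 := by
    simp [lin₁]
    ring
  have h₂ : spaceEval k w (lin₂ k) = 0 := by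
    simp [lin₂]
    ring
  simp [h₁, h₂]

theorem mem_of_spaceEval_eq_zero {w : MvPolynomial (Fin 3) k} (hw : w ≠ 0)
    (F : (MvPolynomial (Fin 5) k)[X]) (hF : spaceEval k w F = 0) :
    F ∈ Ideal.span {lin₁ k, lin₂ k} := by
  let j : MvPolynomial (Fin 3) k →+* MvPolynomial (Fin 5) k :=
    MvPolynomial.eval₂Hom MvPolynomial.C ![X 0, X 1, X 2]
  let ε : MvPolynomial (Fin 5) k →+* MvPolynomial (Fin 5) k :=
    MvPolynomial.eval₂Hom MvPolynomial.C ![0, 0, X 2, X 3, X 4]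
  have h₁ : lin₁ k ∈ Ideal.span {lin₁ k, lin₂ k} := Ideal.subset_span (by simp)
  have h₂ : lin₂ k ∈ Ideal.span {lin₁ k, lin₂ k} := Ideal.subset_span (by simp)
  refine mem_of_normalForm (X 0) (X 1) _ _
    ((X 0 * X 2 - X 1 ^ 2) * X 4 - (X 0 ^ 3 - X 1 * X 2) * X 3) ε ?_ ?_ ?_ ?_ ?_ _ h₁ h₂ ?_
    (spaceEval k w) (spaceEval_eq_zero_of_mem w) ?_ F hF
  · intro f
    have := MvPolynomial.map_sub_map_mem (RingHom.id _) ε (Ideal.span {X 0, X 1})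
      (fun c => by simp [ε]) (fun i => by
        fin_cases i <;> simp [ε] <;> exact Ideal.subset_span (by simp)) f
    obtain ⟨g₁, g₂, hg⟩ := Ideal.mem_span_pair.1 this
    exact ⟨g₁, g₂, by simp only [RingHom.id_apply] at hg; linear_combination -hg⟩
  · have : ε.comp ε = ε :=
      MvPolynomial.ringHom_ext (fun c => by simp [ε]) (fun i => by fin_cases i <;> simp [ε])
    exact fun f => congrArg (· f) this
  · simp [ε]
  · simp [ε, MvPolynomial.X_ne_zero]
  · simp [ε]
  · have := Ideal.sub_mem _ (Ideal.mul_mem_left _ (Polynomial.C (X 1)) h₁)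
      (Ideal.mul_mem_left _ (Polynomial.C (X 0)) h₂)
    convert this using 1
    simp only [lin₁, lin₂, map_sub, map_mul, map_pow]
    ring
  · intro G hG
    have := mem_of_coprime_of_map_eq_zero (R := MvPolynomial (Fin 3) k)
      (a := X 0 * X 2 - X 1 ^ 2) (b := X 0 ^ 3 - X 1 * X 2) (w := w)
      (fun h0 => by simpa using congrArg (MvPolynomial.eval ![0, 1, 0]) h0) hw
      monomialCurve_coprime j (X 3) (X 4) ⊥ ?_ ((spaceEval k w).comp Polynomial.C) (by simp)
      ?_ (by simp [spaceEval]) (by simp [spaceEval]) G hG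
    · rw [sup_bot_eq, Ideal.mem_span_singleton] at this
      simpa [j] using this
    · refine MvPolynomial.surjective_of_mem_range (Ideal.Quotient.mk ⊥)
        Ideal.Quotient.mk_surjective _
        (fun c => ⟨Polynomial.C (Polynomial.C (MvPolynomial.C c)), by simp [j]⟩) (fun i => ?_)
      fin_cases i
      · exact ⟨Polynomial.C (Polynomial.C (X 0)), by simp [j]⟩
      · exact ⟨Polynomial.C (Polynomial.C (X 1)), by simp [j]⟩
      · exact ⟨Polynomial.C (Polynomial.C (X 2)), by simp [j]⟩
      · exact ⟨Polynomial.C Polynomial.X, by simp⟩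
      · exact ⟨Polynomial.X, by simp⟩
    · have : ((spaceEval k w).comp Polynomial.C).comp j = Polynomial.C :=
        MvPolynomial.ringHom_ext (fun c => by simp [spaceEval, j])
          (fun i => by fin_cases i <;> simp [spaceEval, j])
      exact fun c => congrArg (· c) this

@[simp] theorem planeEval_x (ρ : ℕ) : planeEval k ρ (Polynomial.C (X 0)) =
    Polynomial.C (X 0) := by
  simp [planeEval]

@[simp] theorem planeEval_y (ρ : ℕ) : planeEval k ρ (Polynomial.C (X 1)) =
    Polynomial.C (X 1) := by
  simp [planeEval]

@[simp] theorem planeEval_z (ρ : ℕ) : planeEval k ρ (Polynomial.C (X 2)) =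
    Polynomial.C (X 0 ^ (ρ + 1)) := by
  simp [planeEval]

@[simp] theorem planeEval_U (ρ : ℕ) : planeEval k ρ (Polynomial.C (X 3)) =
    Polynomial.C (X 0 ^ (ρ + 2) - X 1 ^ 2) * Polynomial.X := by
  simp [planeEval]

@[simp] theorem planeEval_V (ρ : ℕ) : planeEval k ρ (Polynomial.C (X 4)) =
    Polynomial.C (X 0 ^ 3 - X 0 ^ (ρ + 1) * X 1) * Polynomial.X := by
  simp [planeEval]

@[simp] theorem planeEval_W (ρ : ℕ) : planeEval k ρ Polynomial.X =
    Polynomial.C (X 0 ^ 2 * X 1 - X 0 ^ (2 * ρ + 2)) * Polynomial.X := by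
  simp [planeEval]

theorem planeEval_eq_zero_of_mem (ρ : ℕ) :
    ∀ F ∈ Ideal.span {lin₁ k, lin₂ k} ⊔
      Ideal.span {Polynomial.C (X 2 - X 0 ^ (ρ + 1)), quad k ρ}, planeEval k ρ F = 0 := by
  suffices h : Ideal.span {lin₁ k, lin₂ k} ⊔
      Ideal.span {Polynomial.C (X 2 - X 0 ^ (ρ + 1)), quad k ρ} ≤
        RingHom.ker (planeEval k ρ) from fun F hF => h hF
  simp only [sup_le_iff, Ideal.span_le, Set.insert_subset_iff, Set.singleton_subset_iff,
    SetLike.mem_coe, RingHom.mem_ker]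
  refine ⟨⟨?_, ?_⟩, ?_, ?_⟩ <;> simp [lin₁, lin₂, quad] <;> ring

theorem mem_of_planeEval_eq_zero {ρ : ℕ} (hρ : 2 ≤ ρ)
    (F : (MvPolynomial (Fin 5) k)[X]) (hF : planeEval k ρ F = 0) :
    F ∈ Ideal.span {lin₁ k, lin₂ k} ⊔
      Ideal.span {Polynomial.C (X 2 - X 0 ^ (ρ + 1)), quad k ρ} := by
  let j : MvPolynomial (Fin 2) k →+* MvPolynomial (Fin 5) k :=
    MvPolynomial.eval₂Hom MvPolynomial.C ![X 0, X 1]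
  let ε : MvPolynomial (Fin 5) k →+* MvPolynomial (Fin 5) k :=
    MvPolynomial.eval₂Hom MvPolynomial.C ![0, 0, 0, X 3, X 4]
  let ε' : MvPolynomial (Fin 5) k →+* MvPolynomial (Fin 5) k :=
    MvPolynomial.eval₂Hom MvPolynomial.C ![0, X 1, 0, X 3, X 4]
  set J := Ideal.span {lin₁ k, lin₂ k} ⊔
    Ideal.span {Polynomial.C (X 2 - X 0 ^ (ρ + 1)), quad k ρ} with hJ
  have h₁ : lin₁ k ∈ J := Ideal.mem_sup_left (Ideal.subset_span (by simp))
  have h₂ : lin₂ k ∈ J := Ideal.mem_sup_left (Ideal.subset_span (by simp))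
  have h₃ : Polynomial.C (X 2 - X 0 ^ (ρ + 1)) ∈ J :=
    Ideal.mem_sup_right (Ideal.subset_span (by simp))
  have h₄ : quad k ρ ∈ J := Ideal.mem_sup_right (Ideal.subset_span (by simp))
  have hIJ : ∀ f ∈ Ideal.span {(X 2 - X 0 ^ (ρ + 1) : MvPolynomial (Fin 5) k)},
      Polynomial.C f ∈ J := by
    intro f hf
    obtain ⟨g, rfl⟩ := Ideal.mem_span_singleton.1 hf
    rw [map_mul]
    exact J.mul_mem_right _ h₃
  refine mem_of_normalForm_of_quadratic (X 0) (X 1) _ _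
    ((X 0 ^ (ρ + 2) - X 1 ^ 2) * X 4 - (X 0 ^ 3 - X 0 ^ (ρ + 1) * X 1) * X 3) _ _ (X 4)
    (Ideal.span {X 2 - X 0 ^ (ρ + 1)}) ε ε' ?_ ?_ ?_ ?_ ?_ ?_ (MvPolynomial.X_ne_zero _)
    (MvPolynomial.X_ne_zero _) ?_ ?_ J hIJ h₁ h₂ ?_ h₄
    (planeEval k ρ) (planeEval_eq_zero_of_mem ρ) ?_ F hF
  · intro f
    have := MvPolynomial.map_sub_map_mem (RingHom.id _) ε
      (Ideal.span {X 0, X 1} ⊔ Ideal.span {X 2 - X 0 ^ (ρ + 1)})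
      (fun c => by simp [ε]) (fun i => by
        have hx : (X 0 : MvPolynomial (Fin 5) k) ∈
            Ideal.span {X 0, X 1} ⊔ Ideal.span {X 2 - X 0 ^ (ρ + 1)} :=
          Ideal.mem_sup_left (Ideal.subset_span (by simp))
        have hy : (X 1 : MvPolynomial (Fin 5) k) ∈
            Ideal.span {X 0, X 1} ⊔ Ideal.span {X 2 - X 0 ^ (ρ + 1)} :=
          Ideal.mem_sup_left (Ideal.subset_span (by simp))
        have hz : (X 2 : MvPolynomial (Fin 5) k) ∈
            Ideal.span {X 0, X 1} ⊔ Ideal.span {X 2 - X 0 ^ (ρ + 1)} := by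
          have := Ideal.add_mem _ (Ideal.mem_sup_right (S := Ideal.span {X 0, X 1})
            (Ideal.mem_span_singleton_self (X 2 - X 0 ^ (ρ + 1) : MvPolynomial (Fin 5) k)))
            (Ideal.mul_mem_left _ (X 0 ^ ρ) hx)
          rwa [← pow_succ, sub_add_cancel] at this
        fin_cases i <;> simp [ε] <;> assumption) f
    obtain ⟨s, hs, i, hi, hsi⟩ := Submodule.mem_sup.1 this
    obtain ⟨g₁, g₂, rfl⟩ := Ideal.mem_span_pair.1 hs
    refine ⟨g₁, g₂, ?_⟩
    convert hi using 1
    simp only [RingHom.id_apply] at hsi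
    linear_combination -hsi
  · have : ε.comp ε = ε :=
      MvPolynomial.ringHom_ext (fun c => by simp [ε]) (fun i => by fin_cases i <;> simp [ε])
    exact fun f => congrArg (· f) this
  · have : ε'.comp ε = ε :=
      MvPolynomial.ringHom_ext (fun c => by simp [ε, ε'])
        (fun i => by fin_cases i <;> simp [ε, ε'])
    exact fun f => congrArg (· f) this
  · simp [ε']
  · simp [ε]
  · intro f hf
    obtain ⟨g, rfl⟩ := Ideal.mem_span_singleton.1 hf
    simp [ε']
  · simp [ε']
  · simp [ε']
  · have := Ideal.sub_mem _ (Ideal.sub_mem _ (Ideal.mul_mem_left _ (Polynomial.C (X 1)) h₁)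
      (Ideal.mul_mem_left _ (Polynomial.C (X 0)) h₂))
      (Ideal.mul_mem_left _ (Polynomial.C (X 0 * X 4 + X 1 * X 3)) h₃)
    convert this using 1
    simp only [lin₁, lin₂, map_sub, map_mul, map_pow, map_add]
    ring
  · intro G hG
    have := mem_of_coprime_of_map_eq_zero (R := MvPolynomial (Fin 2) k)
      (a := X 0 ^ (ρ + 2) - X 1 ^ 2) (b := X 0 ^ 3 - X 0 ^ (ρ + 1) * X 1) (w := 1)
      (fun h0 => by simpa using congrArg (MvPolynomial.eval ![0, 1]) h0) one_ne_zero
      (binomialPlane_coprime ρ hρ) j (X 3) (X 4) (Ideal.span {X 2 - X 0 ^ (ρ + 1)}) ?_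
      ((planeEval k ρ).comp Polynomial.C) ?_
      ?_ (by simp [planeEval]) (by simp [planeEval]) G hG
    · simpa [j] using this
    · refine MvPolynomial.surjective_of_mem_range (Ideal.Quotient.mk _)
        Ideal.Quotient.mk_surjective _
        (fun c => ⟨Polynomial.C (Polynomial.C (MvPolynomial.C c)), by simp [j]⟩) (fun i => ?_)
      fin_cases i
      · exact ⟨Polynomial.C (Polynomial.C (X 0)), by simp [j]⟩
      · exact ⟨Polynomial.C (Polynomial.C (X 1)), by simp [j]⟩
      · refine ⟨Polynomial.C (Polynomial.C (X 0 ^ (ρ + 1))), ?_⟩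
        refine ((Ideal.Quotient.mk_eq_mk_iff_sub_mem _ _).2 ?_).symm
        simp [j, Polynomial.eval₂_pow]
      · exact ⟨Polynomial.C Polynomial.X, by simp⟩
      · exact ⟨Polynomial.X, by simp⟩
    · intro g hg
      obtain ⟨g, rfl⟩ := Ideal.mem_span_singleton.1 hg
      simp [planeEval]
    · have : ((planeEval k ρ).comp Polynomial.C).comp j = Polynomial.C :=
        MvPolynomial.ringHom_ext (fun c => by simp [planeEval, j])
          (fun i => by fin_cases i <;> simp [planeEval, j])
      exact fun c => congrArg (· c) this

end Bigraded

section Presentation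

variable (k : Type*) [Field k] (ρ : ℕ)

/-- The generators of the ideal, for `r = ρ + 1`. -/
noncomputable def idealGens : Fin 4 → MvPolynomial (Fin 3) k :=
  ![X 0 ^ 4 - X 1 ^ 3, (X 2 - X 0 ^ (ρ + 1)) * (X 0 * X 2 - X 1 ^ 2),
    (X 2 - X 0 ^ (ρ + 1)) * (X 0 ^ 3 - X 1 * X 2),
    (X 2 - X 0 ^ (ρ + 1)) * (X 0 ^ 2 * X 1 - X 2 ^ 2)]

noncomputable def linRel₁ : MvPolynomial (Fin 4) (MvPolynomial (Fin 3) k) :=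
  MvPolynomial.C (X 2) * X 1 - MvPolynomial.C (X 1) * X 2 + MvPolynomial.C (X 0) * X 3

noncomputable def linRel₂ : MvPolynomial (Fin 4) (MvPolynomial (Fin 3) k) :=
  MvPolynomial.C (X 0 ^ 2) * X 1 - MvPolynomial.C (X 2) * X 2 + MvPolynomial.C (X 1) * X 3

noncomputable def linRel₃ : MvPolynomial (Fin 4) (MvPolynomial (Fin 3) k) :=
  MvPolynomial.C (X 2 - X 0 ^ (ρ + 1)) * X 0 - (MvPolynomial.C (X 0) * X 2 +
    MvPolynomial.C (X 1) * X 1)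

noncomputable def cubicRel : MvPolynomial (Fin 4) (MvPolynomial (Fin 3) k) :=
  X 0 * (X 3 ^ 2 + MvPolynomial.C (X 0 ^ ρ) * X 1 * X 3 + MvPolynomial.C (X 0) * X 1 * X 2 -
    MvPolynomial.C (X 0 ^ ρ) * X 2 ^ 2) - (X 2 ^ 3 + MvPolynomial.C (X 0) * X 1 ^ 3)

/-- Reordering of variables `k[x,y,z,T₁,T₂][T₃][T₀] → k[x,y,z][T₀,T₁,T₂,T₃]`. -/
noncomputable def flatten :
    (MvPolynomial (Fin 5) k)[X][X] →+* MvPolynomial (Fin 4) (MvPolynomial (Fin 3) k) :=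
  Polynomial.eval₂RingHom (Polynomial.eval₂RingHom
    (MvPolynomial.eval₂Hom (MvPolynomial.C.comp MvPolynomial.C)
      ![MvPolynomial.C (X 0), MvPolynomial.C (X 1), MvPolynomial.C (X 2), X 1, X 2]) (X 3)) (X 0)

theorem flatten_surjective : Function.Surjective (flatten k) := by
  let σ : MvPolynomial (Fin 4) (MvPolynomial (Fin 3) k) →+* (MvPolynomial (Fin 5) k)[X][X] :=
    MvPolynomial.eval₂Hom ((Polynomial.C.comp Polynomial.C).comp
      (MvPolynomial.eval₂Hom MvPolynomial.C ![X 0, X 1, X 2]))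
      ![Polynomial.X, Polynomial.C (Polynomial.C (X 3)), Polynomial.C (Polynomial.C (X 4)),
        Polynomial.C Polynomial.X]
  have h : (flatten k).comp σ = RingHom.id _ := by
    refine MvPolynomial.ringHom_ext' (MvPolynomial.ringHom_ext (fun c => ?_) (fun i => ?_))
      (fun i => ?_)
    · simp [σ, flatten]
    · fin_cases i <;> simp [σ, flatten]
    · fin_cases i <;> simp [σ, flatten]
  exact fun F => ⟨σ F, congrArg (· F) h⟩

theorem span_rels_le_reesKer :
    Ideal.span {linRel₁ k, linRel₂ k, linRel₃ k ρ, cubicRel k ρ} ≤ reesKer (idealGens k ρ) := by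
  simp only [Ideal.span_le, Set.insert_subset_iff, Set.singleton_subset_iff, SetLike.mem_coe,
    reesKer, RingHom.mem_ker]
  refine ⟨?_, ?_, ?_, ?_⟩ <;>
  · simp [linRel₁, linRel₂, linRel₃, cubicRel, idealGens]
    ring

variable {ρ}

theorem reesKer_idealGens (hρ : 2 ≤ ρ) :
    reesKer (idealGens k ρ) =
      Ideal.span {linRel₁ k, linRel₂ k, linRel₃ k ρ, cubicRel k ρ} := by
  refine le_antisymm (fun F hF => ?_) (span_rels_le_reesKer k ρ)
  obtain ⟨F, rfl⟩ := flatten_surjective k F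
  set L := Ideal.span {linRel₁ k, linRel₂ k, linRel₃ k ρ, cubicRel k ρ} with hL
  have hw : (X 2 - X 0 ^ (ρ + 1) : MvPolynomial (Fin 3) k) ≠ 0 := fun h0 => by
    simpa using congrArg (MvPolynomial.eval ![0, 0, 1]) h0
  let Φ : (MvPolynomial (Fin 5) k)[X][X] →+* (MvPolynomial (Fin 3) k)[X] :=
    (MvPolynomial.aeval (fun i => Polynomial.C (idealGens k ρ i) * Polynomial.X) :
      MvPolynomial (Fin 4) (MvPolynomial (Fin 3) k) →ₐ[_] _).toRingHom.comp (flatten k)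
  have hΦ : Φ.comp Polynomial.C = spaceEval k (X 2 - X 0 ^ (ρ + 1)) := by
    refine Polynomial.ringHom_ext' (MvPolynomial.ringHom_ext (fun c => ?_) (fun i => ?_)) ?_
    · simp [Φ, flatten, spaceEval]
    · fin_cases i <;> simp [Φ, flatten, spaceEval, idealGens]
    · simp [Φ, flatten, spaceEval, idealGens]
  have hmem : ∀ p ∈ ({linRel₁ k, linRel₂ k, linRel₃ k ρ, cubicRel k ρ} : Set _), p ∈ L :=
    fun p hp => Ideal.subset_span hp
  refine mem_of_residue (Polynomial.C (X 2 - X 0 ^ (ρ + 1)))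
    (Polynomial.C (X 0 * X 4 + X 1 * X 3)) (quad k ρ) (Polynomial.C (X 4 ^ 3 + X 0 * X 3 ^ 3))
    Φ (planeEval k ρ) (Ideal.span {lin₁ k, lin₂ k}) (fun G hG => ?_)
    (fun G hG => planeEval_eq_zero_of_mem ρ G (Ideal.mem_sup_left hG)) (by simp) ?_
    (fun G hG => mem_of_planeEval_eq_zero hρ G hG) (L.comap (flatten k)) (fun G hG => ?_) ?_ ?_
    (fun G hG => span_rels_le_reesKer k ρ hG) F hF
  · exact mem_of_spaceEval_eq_zero hw G (hΦ ▸ hG)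
  · intro h0
    have h1 := congrArg (fun p => MvPolynomial.eval ![0, 1] (Polynomial.eval 1 p)) h0
    simp at h1
  · obtain ⟨α, β, rfl⟩ := Ideal.mem_span_pair.1 hG
    rw [Ideal.mem_comap, map_add, map_add, map_mul, map_mul, map_mul, map_mul]
    refine L.add_mem (L.mul_mem_left _ ?_) (L.mul_mem_left _ ?_)
    · convert hmem (linRel₁ k) (by simp) using 1
      simp [lin₁, flatten, linRel₁]
      ring
    · convert hmem (linRel₂ k) (by simp) using 1
      simp [lin₂, flatten, linRel₂, Polynomial.eval₂_pow]
      ring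
  · rw [Ideal.mem_comap]
    convert hmem (linRel₃ k ρ) (by simp) using 1
    simp [flatten, linRel₃, Polynomial.eval₂_pow]
  · rw [Ideal.mem_comap]
    convert hmem (cubicRel k ρ) (by simp) using 1
    simp [flatten, quad, cubicRel, Polynomial.eval₂_pow]
    ring

end Presentation

theorem mem_reesKer {R : Type*} [CommRing R] {s : ℕ} {f : Fin s → R}
    {p : MvPolynomial (Fin s) R} :
    p ∈ reesKer f ↔
      MvPolynomial.aeval (fun i => Polynomial.C (f i) * Polynomial.X : Fin s → R[X]) p = 0 :=
  Iff.rfl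

/-- The substitution of linear forms for the variables. -/
noncomputable def linSubst {R : Type*} [CommRing R] {s t : ℕ} (M : Fin t → Fin s → R) :
    MvPolynomial (Fin t) R →ₐ[R] MvPolynomial (Fin s) R :=
  MvPolynomial.aeval fun j => ∑ i, MvPolynomial.C (M j i) * X i

theorem isHomogeneous_linSubst {R : Type*} [CommRing R] {s t : ℕ} (M : Fin t → Fin s → R)
    {p : MvPolynomial (Fin t) R} {q : ℕ} (hp : p.IsHomogeneous q) :
    (linSubst M p).IsHomogeneous q := by
  have := hp.aeval (fun j => ∑ i, MvPolynomial.C (M j i) * X i : Fin t → MvPolynomial (Fin s) R)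
    (n := 1) (fun j => MvPolynomial.IsHomogeneous.sum _ _ _ fun i _ =>
      MvPolynomial.isHomogeneous_C_mul_X _ _)
  rwa [one_mul] at this

theorem aeval_linSubst {R : Type*} [CommRing R] {s t : ℕ} {f : Fin s → R}
    {g : Fin t → R} {M : Fin t → Fin s → R} (hM : ∀ j, ∑ i, M j i * f i = g j)
    (p : MvPolynomial (Fin t) R) :
    MvPolynomial.aeval (fun i => Polynomial.C (f i) * Polynomial.X : Fin s → R[X])
        (linSubst M p) =
      MvPolynomial.aeval (fun j => Polynomial.C (g j) * Polynomial.X : Fin t → R[X]) p := by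
  rw [linSubst, ← AlgHom.comp_apply, MvPolynomial.comp_aeval]
  simp only [← hM, map_sum, map_mul, MvPolynomial.aeval_X, MvPolynomial.algHom_C,
    Finset.sum_mul, mul_assoc]
  rfl

theorem linSubst_mem_reesKer_iff {R : Type*} [CommRing R] {s t : ℕ} {f : Fin s → R}
    {g : Fin t → R} {M : Fin t → Fin s → R} (hM : ∀ j, ∑ i, M j i * f i = g j)
    {p : MvPolynomial (Fin t) R} : linSubst M p ∈ reesKer f ↔ p ∈ reesKer g := by
  rw [mem_reesKer, mem_reesKer, aeval_linSubst hM]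

theorem X_sub_linSubst_mem_reesKer {R : Type*} [CommRing R] {s t : ℕ} {f : Fin s → R}
    {g : Fin t → R} {M : Fin t → Fin s → R} {N : Fin s → Fin t → R}
    (hM : ∀ j, ∑ i, M j i * f i = g j) (hN : ∀ i, ∑ j, N i j * g j = f i) (j : Fin t) :
    X j - linSubst N (linSubst M (X j)) ∈ reesKer g := by
  rw [mem_reesKer, map_sub, aeval_linSubst hN, aeval_linSubst hM, sub_self]

theorem GenInDegLE.of_span_eq {R : Type*} [CommRing R] {s t : ℕ} {f : Fin s → R} {g : Fin t → R}
    (h : Ideal.span (Set.range f) = Ideal.span (Set.range g)) {n : ℕ} (hn : 1 ≤ n)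
    (hf : GenInDegLE (reesKer f) n) : GenInDegLE (reesKer g) n := by
  have hM : ∀ j, ∃ c : Fin s → R, ∑ i, c i * f i = g j := fun j =>
    Ideal.mem_span_range_iff_exists_fun.1 (h ▸ Ideal.subset_span ⟨j, rfl⟩)
  have hN : ∀ i, ∃ c : Fin t → R, ∑ j, c j * g j = f i := fun i =>
    Ideal.mem_span_range_iff_exists_fun.1 (h ▸ Ideal.subset_span ⟨i, rfl⟩)
  choose M hM using hM
  choose N hN using hN
  refine le_antisymm (fun p hp => ?_) (Ideal.span_le.2 fun p hp => hp.1)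
  set L := Ideal.span {p | p ∈ reesKer g ∧ ∃ q ≤ n, MvPolynomial.IsHomogeneous p q} with hL
  have h₁ : linSubst N (linSubst M p) ∈ L := by
    have h₂ : reesKer f ≤ L.comap (linSubst N) := by
      rw [hf, Ideal.span_le]
      rintro p ⟨hp, q, hq, hpq⟩
      exact Ideal.subset_span ⟨(linSubst_mem_reesKer_iff hN).2 hp, q, hq,
        isHomogeneous_linSubst N hpq⟩
    exact h₂ ((linSubst_mem_reesKer_iff hM).2 hp)
  have h₃ := MvPolynomial.map_sub_map_mem (RingHom.id _)
    ((linSubst N).comp (linSubst M)).toRingHom L (fun c => by simp [linSubst]) (fun j =>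
      Ideal.subset_span ⟨X_sub_linSubst_mem_reesKer hM hN j, 1, hn,
        (MvPolynomial.isHomogeneous_X _ _).sub (isHomogeneous_linSubst N
          (isHomogeneous_linSubst M (MvPolynomial.isHomogeneous_X _ _)))⟩) p
  simpa using L.add_mem h₃ h₁

theorem relType_eq_of_genInDegLE {R : Type*} [CommRing R] {s : ℕ} (f : Fin s → R) {n : ℕ}
    (hn : 1 ≤ n) (h : GenInDegLE (reesKer f) n)
    (h' : ∀ m < n, ¬ GenInDegLE (reesKer f) m) : relType (Ideal.span (Set.range f)) = n := by
  refine le_antisymm (Nat.sInf_le ⟨hn, fun s g hg => h.of_span_eq hg.symm hn⟩) ?_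
  exact le_csInf ⟨n, hn, fun s g hg => h.of_span_eq hg.symm hn⟩ fun m hm =>
    not_lt.1 fun hlt => h' m hlt (hm.2 s f rfl)

theorem le_of_span_eq_of_map_eq_zero {R k : Type*} [CommRing R] [Field k] (ε : R →+* k)
    {s t : ℕ} {f : Fin s → R} {g : Fin t → R}
    (h : Ideal.span (Set.range g) = Ideal.span (Set.range f))
    (hε : ∀ p ∈ reesKer f, p.IsHomogeneous 1 → MvPolynomial.map ε p = 0) : s ≤ t := by
  have hM : ∀ j, ∃ c : Fin s → R, ∑ i, c i * f i = g j := fun j =>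
    Ideal.mem_span_range_iff_exists_fun.1 (h ▸ Ideal.subset_span ⟨j, rfl⟩)
  have hN : ∀ i, ∃ c : Fin t → R, ∑ j, c j * g j = f i := fun i =>
    Ideal.mem_span_range_iff_exists_fun.1 (h ▸ Ideal.subset_span ⟨i, rfl⟩)
  choose M hM using hM
  choose N hN using hN
  let N' : Matrix (Fin s) (Fin t) k := Matrix.of fun i j => ε (N i j)
  let M' : Matrix (Fin t) (Fin s) k := Matrix.of fun j i => ε (M j i)
  have hNM : N' * M' = 1 := by
    ext i i'
    have h₁ := hε _ (X_sub_linSubst_mem_reesKer hN hM i)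
      ((MvPolynomial.isHomogeneous_X _ _).sub (isHomogeneous_linSubst M
          (isHomogeneous_linSubst N (MvPolynomial.isHomogeneous_X _ _))))
    have h₂ := congrArg (MvPolynomial.eval (Pi.single i' 1)) h₁
    simp only [linSubst, map_sub, MvPolynomial.aeval_X, map_sum, map_mul, MvPolynomial.map_X,
      MvPolynomial.algHom_C, MvPolynomial.algebraMap_eq, MvPolynomial.map_C, MvPolynomial.eval_X,
      MvPolynomial.eval_C, Pi.single_apply, mul_ite, mul_one, mul_zero, Finset.sum_ite_eq',
      Finset.mem_univ, if_true, map_zero, sub_eq_zero] at h₂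
    rw [Matrix.mul_apply, Matrix.one_apply]
    simpa [N', M'] using h₂.symm
  have h₃ := Matrix.rank_mul_le_left N' M'
  rw [hNM, Matrix.rank_one, Fintype.card_fin] at h₃
  simpa using h₃.trans (Matrix.rank_le_width N')

section RelationType

variable (k : Type*) [Field k]

/-- The cubic equation modulo the maximal ideal `(x, y, z)`. -/
noncomputable def fiberCubic : MvPolynomial (Fin 4) k := X 0 * X 3 ^ 2 - X 2 ^ 3

theorem fiberCubic_ne_zero : fiberCubic k ≠ 0 := fun h0 => by
  simpa [fiberCubic] using congrArg (MvPolynomial.eval ![1, 0, 0, 1]) h0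

theorem isHomogeneous_fiberCubic : (fiberCubic k).IsHomogeneous 3 :=
  ((MvPolynomial.isHomogeneous_X _ _).mul (MvPolynomial.isHomogeneous_X_pow _ _)).sub
    (MvPolynomial.isHomogeneous_X_pow _ _)

variable {k} {ρ : ℕ}

theorem map_cubicRel (hρ : ρ ≠ 0) :
    MvPolynomial.map MvPolynomial.constantCoeff (cubicRel k ρ) = fiberCubic k := by
  simp [cubicRel, fiberCubic, hρ]

theorem fiberCubic_dvd_of_mem (hρ : 2 ≤ ρ) {p : MvPolynomial (Fin 4) (MvPolynomial (Fin 3) k)}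
    (hp : p ∈ reesKer (idealGens k ρ)) :
    fiberCubic k ∣ MvPolynomial.map MvPolynomial.constantCoeff p := by
  rw [← Ideal.mem_span_singleton, ← Ideal.mem_comap]
  refine (?_ : reesKer (idealGens k ρ) ≤ _) hp
  rw [reesKer_idealGens k hρ]
  simp only [Ideal.span_le, Set.insert_subset_iff, Set.singleton_subset_iff, SetLike.mem_coe,
    Ideal.mem_comap, map_cubicRel (show ρ ≠ 0 by omega), Ideal.mem_span_singleton_self]
  refine ⟨?_, ?_, ?_, trivial⟩ <;> simp [linRel₁, linRel₂, linRel₃]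

theorem map_constantCoeff_eq_zero (hρ : 2 ≤ ρ)
    {p : MvPolynomial (Fin 4) (MvPolynomial (Fin 3) k)} (hp : p ∈ reesKer (idealGens k ρ)) {q : ℕ}
    (hpq : p.IsHomogeneous q) (hq : q < 3) :
    MvPolynomial.map MvPolynomial.constantCoeff p = 0 := by
  by_contra h0
  obtain ⟨c, hc⟩ := fiberCubic_dvd_of_mem hρ hp
  have h₁ := (hpq.map MvPolynomial.constantCoeff).totalDegree_le
  rw [hc] at h0 h₁
  rw [MvPolynomial.totalDegree_mul_of_isDomain (fiberCubic_ne_zero k) (right_ne_zero_of_mul h0),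
    (isHomogeneous_fiberCubic k).totalDegree (fiberCubic_ne_zero k)] at h₁
  omega

theorem genInDegLE_reesKer_idealGens (hρ : 2 ≤ ρ) :
    GenInDegLE (reesKer (idealGens k ρ)) 3 := by
  refine le_antisymm ?_ (Ideal.span_le.2 fun p hp => hp.1)
  have hX := MvPolynomial.isHomogeneous_X (σ := Fin 4) (MvPolynomial (Fin 3) k)
  have hCX := MvPolynomial.isHomogeneous_C_mul_X (σ := Fin 4) (R := MvPolynomial (Fin 3) k)
  conv_lhs => rw [reesKer_idealGens k hρ]
  refine Ideal.span_le.2 fun p hp =>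
    Ideal.subset_span ⟨span_rels_le_reesKer k ρ (Ideal.subset_span hp), ?_⟩
  simp only [Set.mem_insert_iff, Set.mem_singleton_iff] at hp
  rcases hp with rfl | rfl | rfl | rfl
  · exact ⟨1, by norm_num, ((hCX _ _).sub (hCX _ _)).add (hCX _ _)⟩
  · exact ⟨1, by norm_num, ((hCX _ _).sub (hCX _ _)).add (hCX _ _)⟩
  · exact ⟨1, by norm_num, (hCX _ _).sub ((hCX _ _).add (hCX _ _))⟩
  · exact ⟨3, le_rfl, ((hX 0).mul (((((hX 3).pow 2).add ((hCX _ _).mul (hX 3))).add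
      ((hCX _ _).mul (hX 2))).sub (((hX 2).pow 2).C_mul _))).sub
      (((hX 2).pow 3).add (((hX 1).pow 3).C_mul _))⟩

theorem not_genInDegLE_reesKer_idealGens (hρ : 2 ≤ ρ) {n : ℕ} (hn : n < 3) :
    ¬ GenInDegLE (reesKer (idealGens k ρ)) n := by
  intro h
  have hle : reesKer (idealGens k ρ) ≤
      RingHom.ker (MvPolynomial.map (σ := Fin 4) (MvPolynomial.constantCoeff (R := k)
        (σ := Fin 3))) := by
    rw [h, Ideal.span_le]
    rintro p ⟨hp, q, hq, hpq⟩
    exact map_constantCoeff_eq_zero hρ hp hpq (by omega)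
  have hmem : cubicRel k ρ ∈ reesKer (idealGens k ρ) :=
    span_rels_le_reesKer k ρ (Ideal.subset_span (by simp))
  have h0 := hle hmem
  rw [RingHom.mem_ker, map_cubicRel (show ρ ≠ 0 by omega)] at h0
  exact fiberCubic_ne_zero k h0

theorem relType_span_idealGens (hρ : 2 ≤ ρ) :
    relType (Ideal.span (Set.range (idealGens k ρ))) = 3 :=
  relType_eq_of_genInDegLE _ (by norm_num) (genInDegLE_reesKer_idealGens hρ)
    fun _ hm => not_genInDegLE_reesKer_idealGens hρ hm

theorem four_le_of_span_eq (hρ : 2 ≤ ρ) {s : ℕ} {g : Fin s → MvPolynomial (Fin 3) k}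
    (hg : Ideal.span (Set.range g) = Ideal.span (Set.range (idealGens k ρ))) : 4 ≤ s := by
  have h : ∀ p ∈ reesKer (idealGens k ρ), p.IsHomogeneous 1 →
      MvPolynomial.map MvPolynomial.constantCoeff p = 0 :=
    fun p hp hp1 => map_constantCoeff_eq_zero hρ hp hp1 (by norm_num)
  exact le_of_span_eq_of_map_eq_zero (R := MvPolynomial (Fin 3) k) (k := k)
    MvPolynomial.constantCoeff hg h

end RelationType

theorem eq_zero_of_expand_add_eq_zero {k : Type*} [CommRing k] {i j : ℕ} (hi : ¬ i ≡ 0 [MOD 3])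
    (hj : ¬ j ≡ 0 [MOD 3]) (hij : ¬ i ≡ j [MOD 3]) {d₀ d₁ d₂ : k[X]}
    (h : Polynomial.expand k 3 d₀ + Polynomial.expand k 3 d₁ * Polynomial.X ^ i +
      Polynomial.expand k 3 d₂ * Polynomial.X ^ j = 0) : d₀ = 0 ∧ d₁ = 0 ∧ d₂ = 0 := by
  have hne : ∀ (d : k[X]) (l m : ℕ), ¬ m ≡ l [MOD 3] →
      (Polynomial.expand k 3 d * Polynomial.X ^ l).coeff m = 0 := by
    intro d l m hm
    unfold Nat.ModEq at hm
    rw [Polynomial.coeff_mul_X_pow', Polynomial.coeff_expand three_pos]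
    split_ifs
    · omega
    · rfl
    · rfl
  have heq : ∀ (d : k[X]) (l n : ℕ),
      (Polynomial.expand k 3 d * Polynomial.X ^ l).coeff (n * 3 + l) = d.coeff n := fun d l n => by
    rw [Polynomial.coeff_mul_X_pow, Polynomial.coeff_expand_mul three_pos]
  have h' : ∀ m, (Polynomial.expand k 3 d₀ * Polynomial.X ^ 0).coeff m +
      (Polynomial.expand k 3 d₁ * Polynomial.X ^ i).coeff m +
      (Polynomial.expand k 3 d₂ * Polynomial.X ^ j).coeff m = 0 := fun m => by
    simpa using congrArg (Polynomial.coeff · m) h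
  unfold Nat.ModEq at hi hj hij hne
  refine ⟨?_, ?_, ?_⟩ <;> ext n
  · have := h' (n * 3 + 0)
    rwa [heq, hne _ i _ (by omega), hne _ j _ (by omega), add_zero, add_zero] at this
  · have := h' (n * 3 + i)
    rwa [heq, hne _ 0 _ (by omega), hne _ j _ (by omega), zero_add, add_zero] at this
  · have := h' (n * 3 + j)
    rwa [heq, hne _ 0 _ (by omega), hne _ i _ (by omega), zero_add, zero_add] at this

theorem exists_sub_mem_of_forall_X {k σ : Type*} [CommRing k] (N : Ideal (MvPolynomial σ k))
    (ι : k[X] →+* MvPolynomial σ k) (hι : ∀ c, ι (Polynomial.C c) = MvPolynomial.C c)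
    (u v : MvPolynomial σ k)
    (h : ∀ i, ∀ p ∈ ({1, u, v} : Set (MvPolynomial σ k)),
      ∃ d₀ d₁ d₂, p * X i - (ι d₀ + ι d₁ * u + ι d₂ * v) ∈ N)
    (f : MvPolynomial σ k) : ∃ d₀ d₁ d₂, f - (ι d₀ + ι d₁ * u + ι d₂ * v) ∈ N := by
  induction f using MvPolynomial.induction_on with
  | C c => exact ⟨Polynomial.C c, 0, 0, by simp [hι]⟩
  | add f g hf hg =>
    obtain ⟨a₀, a₁, a₂, ha⟩ := hf
    obtain ⟨b₀, b₁, b₂, hb⟩ := hg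
    refine ⟨a₀ + b₀, a₁ + b₁, a₂ + b₂, ?_⟩
    convert N.add_mem ha hb using 1
    simp only [map_add]
    ring
  | mul_X f i hf =>
    obtain ⟨a₀, a₁, a₂, ha⟩ := hf
    obtain ⟨b₀, b₁, b₂, hb⟩ := h i 1 (by simp)
    obtain ⟨c₀, c₁, c₂, hc⟩ := h i u (by simp)
    obtain ⟨e₀, e₁, e₂, he⟩ := h i v (by simp)
    refine ⟨a₀ * b₀ + a₁ * c₀ + a₂ * e₀, a₀ * b₁ + a₁ * c₁ + a₂ * e₁,
      a₀ * b₂ + a₁ * c₂ + a₂ * e₂, ?_⟩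
    convert N.add_mem (N.add_mem (N.add_mem (N.mul_mem_left (X i) ha) (N.mul_mem_left (ι a₀) hb))
      (N.mul_mem_left (ι a₁) hc)) (N.mul_mem_left (ι a₂) he) using 1
    simp only [map_add, map_mul]
    ring

theorem mem_of_monomialCurve_eq_zero {k σ : Type*} [CommRing k] (N : Ideal (MvPolynomial σ k))
    (ι : k[X] →+* MvPolynomial σ k) (hι : ∀ c, ι (Polynomial.C c) = MvPolynomial.C c)
    (u v : MvPolynomial σ k)
    (h : ∀ i, ∀ p ∈ ({1, u, v} : Set (MvPolynomial σ k)),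
      ∃ d₀ d₁ d₂, p * X i - (ι d₀ + ι d₁ * u + ι d₂ * v) ∈ N)
    (φ : MvPolynomial σ k →+* k[X]) (hN : ∀ f ∈ N, φ f = 0)
    (hφ : ∀ d, φ (ι d) = Polynomial.expand k 3 d) {i j : ℕ} (hi : ¬ i ≡ 0 [MOD 3])
    (hj : ¬ j ≡ 0 [MOD 3]) (hij : ¬ i ≡ j [MOD 3]) (hu : φ u = Polynomial.X ^ i)
    (hv : φ v = Polynomial.X ^ j) (f : MvPolynomial σ k) (hf : φ f = 0) : f ∈ N := by
  obtain ⟨d₀, d₁, d₂, hd⟩ := exists_sub_mem_of_forall_X N ι hι u v h f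
  have h₀ := hN _ hd
  rw [map_sub, hf, zero_sub, neg_eq_zero, map_add, map_add, map_mul, map_mul, hφ, hφ, hφ, hu,
    hv] at h₀
  obtain ⟨rfl, rfl, rfl⟩ := eq_zero_of_expand_add_eq_zero hi hj hij h₀
  simpa using hd

section MonomialPrimes

variable (k : Type*) [Field k]

/-- The evaluation `x, y, z ↦ t³, t⁴, tⁿ`. -/
noncomputable def curveEval (n : ℕ) : MvPolynomial (Fin 3) k →ₐ[k] k[X] :=
  MvPolynomial.aeval ![(Polynomial.X : k[X]) ^ 3, Polynomial.X ^ 4, Polynomial.X ^ n]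

variable {k}

theorem curveEval_eval₂ (n : ℕ) (d : k[X]) : curveEval k n
    (Polynomial.eval₂RingHom MvPolynomial.C (X 0) d) = Polynomial.expand k 3 d := by
  have : (curveEval k n).toRingHom.comp (Polynomial.eval₂RingHom MvPolynomial.C (X 0)) =
      (Polynomial.expand k 3).toRingHom :=
    Polynomial.ringHom_ext (fun c => by simp [curveEval]) (by simp [curveEval])
  exact congrArg (· d) this

theorem mem_span_of_curveEval_five {f : MvPolynomial (Fin 3) k} (hf : curveEval k 5 f = 0) :
    f ∈ Ideal.span {X 0 * X 2 - X 1 ^ 2, X 0 ^ 3 - X 1 * X 2, X 0 ^ 2 * X 1 - X 2 ^ 2} := by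
  set N : Ideal (MvPolynomial (Fin 3) k) :=
    Ideal.span {X 0 * X 2 - X 1 ^ 2, X 0 ^ 3 - X 1 * X 2, X 0 ^ 2 * X 1 - X 2 ^ 2} with hN
  have h : ∀ p ∈ ({X 0 * X 2 - X 1 ^ 2, X 0 ^ 3 - X 1 * X 2, X 0 ^ 2 * X 1 - X 2 ^ 2} :
      Set (MvPolynomial (Fin 3) k)), p ∈ N := fun p hp => Ideal.subset_span hp
  simp only [Set.mem_insert_iff, Set.mem_singleton_iff, forall_eq_or_imp, forall_eq] at h
  obtain ⟨ha, hb, hc⟩ := h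
  refine mem_of_monomialCurve_eq_zero N (Polynomial.eval₂RingHom MvPolynomial.C (X 0))
    (fun c => by simp) (X 1) (X 2) (fun i p hp => ?_)
    (curveEval k 5 : MvPolynomial (Fin 3) k →+* k[X]) ?_ (curveEval_eval₂ 5) (i := 4) (j := 5)
    (by decide) (by decide) (by decide) (by simp [curveEval]) (by simp [curveEval]) f hf
  · simp only [Set.mem_insert_iff, Set.mem_singleton_iff] at hp
    fin_cases i <;> rcases hp with rfl | rfl | rfl
    · exact ⟨Polynomial.X, 0, 0, by simp⟩
    · exact ⟨0, Polynomial.X, 0, by simp [mul_comm]⟩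
    · exact ⟨0, 0, Polynomial.X, by simp [mul_comm]⟩
    · exact ⟨0, 1, 0, by simp⟩
    · exact ⟨0, 0, Polynomial.X, by
        convert N.neg_mem ha using 1
        simp
        ring⟩
    · exact ⟨Polynomial.X ^ 3, 0, 0, by
        convert N.neg_mem hb using 1
        simp [Polynomial.eval₂_pow]
        ring⟩
    · exact ⟨0, 0, 1, by simp⟩
    · exact ⟨Polynomial.X ^ 3, 0, 0, by
        convert N.neg_mem hb using 1
        simp [Polynomial.eval₂_pow]⟩
    · exact ⟨0, Polynomial.X ^ 2, 0, by
        convert N.neg_mem hc using 1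
        simp [Polynomial.eval₂_pow]
        ring⟩
  · suffices h : N ≤ RingHom.ker (curveEval k 5) from fun f hf => h hf
    rw [hN]
    simp only [Ideal.span_le, Set.insert_subset_iff, Set.singleton_subset_iff, SetLike.mem_coe,
      RingHom.mem_ker]
    refine ⟨?_, ?_, ?_⟩ <;> simp [curveEval] <;> ring

theorem mem_span_of_curveEval_three_mul (r : ℕ) {f : MvPolynomial (Fin 3) k}
    (hf : curveEval k (3 * r) f = 0) : f ∈ Ideal.span {X 0 ^ 4 - X 1 ^ 3, X 2 - X 0 ^ r} := by
  set N : Ideal (MvPolynomial (Fin 3) k) :=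
    Ideal.span {X 0 ^ 4 - X 1 ^ 3, X 2 - X 0 ^ r} with hN
  have ha : (X 0 ^ 4 - X 1 ^ 3 : MvPolynomial (Fin 3) k) ∈ N := Ideal.subset_span (by simp)
  have hb : (X 2 - X 0 ^ r : MvPolynomial (Fin 3) k) ∈ N := Ideal.subset_span (by simp)
  refine mem_of_monomialCurve_eq_zero N (Polynomial.eval₂RingHom MvPolynomial.C (X 0))
    (fun c => by simp) (X 1) (X 1 ^ 2) (fun i p hp => ?_)
    (curveEval k (3 * r) : MvPolynomial (Fin 3) k →+* k[X]) ?_ (curveEval_eval₂ _)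
    (i := 4) (j := 8) (by decide) (by decide) (by decide) (by simp [curveEval])
    (by simp [curveEval]; ring) f hf
  · simp only [Set.mem_insert_iff, Set.mem_singleton_iff] at hp
    fin_cases i <;> rcases hp with rfl | rfl | rfl
    · exact ⟨Polynomial.X, 0, 0, by simp⟩
    · exact ⟨0, Polynomial.X, 0, by simp [mul_comm]⟩
    · exact ⟨0, 0, Polynomial.X, by simp [mul_comm]⟩
    · exact ⟨0, 1, 0, by simp⟩
    · exact ⟨0, 0, 1, by simp [← sq]⟩
    · exact ⟨Polynomial.X ^ 4, 0, 0, by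
        convert N.neg_mem ha using 1
        simp [Polynomial.eval₂_pow]
        ring⟩
    · exact ⟨Polynomial.X ^ r, 0, 0, by simpa [Polynomial.eval₂_pow] using hb⟩
    · exact ⟨0, Polynomial.X ^ r, 0, by
        convert N.mul_mem_left (X 1) hb using 1
        simp [Polynomial.eval₂_pow]
        ring⟩
    · exact ⟨0, 0, Polynomial.X ^ r, by
        convert N.mul_mem_left (X 1 ^ 2) hb using 1
        simp [Polynomial.eval₂_pow]
        ring⟩
  · suffices h : N ≤ RingHom.ker (curveEval k (3 * r)) from fun f hf => h hf
    rw [hN]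
    simp only [Ideal.span_le, Set.insert_subset_iff, Set.singleton_subset_iff, SetLike.mem_coe,
      RingHom.mem_ker]
    refine ⟨?_, ?_⟩ <;> simp [curveEval] <;> ring

theorem ker_inf_ker_eq_span_idealGens (ρ : ℕ) :
    RingHom.ker (curveEval k 5) ⊓ RingHom.ker (curveEval k (3 * (ρ + 1))) =
      Ideal.span (Set.range (idealGens k ρ)) := by
  refine le_antisymm (fun h hh => ?_) (Ideal.span_le.2 ?_)
  · obtain ⟨h₁, h₂⟩ := Ideal.mem_inf.1 hh
    rw [RingHom.mem_ker] at h₁ h₂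
    obtain ⟨α, β, rfl⟩ := Ideal.mem_span_pair.1 (mem_span_of_curveEval_three_mul _ h₂)
    have hβ : curveEval k 5 β = 0 := by
      have hf : curveEval k 5 (X 0 ^ 4 - X 1 ^ 3) = 0 := by
        simp [curveEval]
        ring
      have hw : curveEval k 5 (X 2 - X 0 ^ (ρ + 1)) ≠ 0 := by
        intro h0
        have := congrArg (Polynomial.coeff · 5) h0
        simp only [curveEval, map_sub, map_pow, MvPolynomial.aeval_X, ← pow_mul,
          Matrix.cons_val, Polynomial.coeff_sub, Polynomial.coeff_X_pow] at this
        rw [if_neg (show 5 ≠ 3 * (ρ + 1) by omega)] at this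
        simp at this
      rw [map_add, map_mul, map_mul, hf, mul_zero, zero_add] at h₁
      exact (mul_eq_zero.1 h₁).resolve_right hw
    have hgen : ∀ i, idealGens k ρ i ∈ Ideal.span (Set.range (idealGens k ρ)) :=
      fun i => Ideal.subset_span ⟨i, rfl⟩
    obtain ⟨a, b, c, rfl⟩ := Submodule.mem_span_triple.1 (mem_span_of_curveEval_five hβ)
    convert Ideal.add_mem _ (Ideal.mul_mem_left _ α (hgen 0)) (Ideal.add_mem _
      (Ideal.mul_mem_left _ a (hgen 1)) (Ideal.add_mem _ (Ideal.mul_mem_left _ b (hgen 2))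
      (Ideal.mul_mem_left _ c (hgen 3)))) using 1
    simp [idealGens]
    ring
  · rintro _ ⟨i, rfl⟩
    rw [SetLike.mem_coe, Ideal.mem_inf, RingHom.mem_ker, RingHom.mem_ker]
    fin_cases i <;> constructor <;> simp [idealGens, curveEval] <;> ring_nf <;> simp

end MonomialPrimes

/-- Let `r ≥ 3`, `𝔭ₙ = ker(k[x,y,z] → k[t])` for `x,y,z ↦ t³,t⁴,t⁵`, and
`𝔭ₘ = ker(k[x,y,z] → k[t])` for `x,y,z ↦ t³,t⁴,t^{3r}`. Then `I = 𝔭ₙ ∩ 𝔭ₘ` is minimally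
generated by `f₁ = x⁴ - y³`, `f₂ = -x^{r+1}z + x^r y² + xz² - y²z`,
`f₃ = -x^{r+3} + x^r yz + x³z - yz²`, `f₄ = -x^{r+2}y + x^r z² + x²yz - z³`, and `rt(I) = 3`. -/
theorem relType_intersection_two_monomial_primes {k : Type*} [Field k]
    (r : ℕ) (hr : 3 ≤ r) :
    let 𝔭n : Ideal (MvPolynomial (Fin 3) k) :=
      RingHom.ker (MvPolynomial.aeval
        ![(Polynomial.X : Polynomial k) ^ 3, Polynomial.X ^ 4, Polynomial.X ^ 5] :
        MvPolynomial (Fin 3) k →ₐ[k] Polynomial k)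
    let 𝔭m : Ideal (MvPolynomial (Fin 3) k) :=
      RingHom.ker (MvPolynomial.aeval
        ![(Polynomial.X : Polynomial k) ^ 3, Polynomial.X ^ 4, Polynomial.X ^ (3 * r)] :
        MvPolynomial (Fin 3) k →ₐ[k] Polynomial k)
    let I := 𝔭n ⊓ 𝔭m
    let f₁ : MvPolynomial (Fin 3) k := X 0 ^ 4 - X 1 ^ 3
    let f₂ : MvPolynomial (Fin 3) k :=
      -(X 0 ^ (r + 1) * X 2) + X 0 ^ r * X 1 ^ 2 + X 0 * X 2 ^ 2 - X 1 ^ 2 * X 2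
    let f₃ : MvPolynomial (Fin 3) k :=
      -(X 0 ^ (r + 3)) + X 0 ^ r * X 1 * X 2 + X 0 ^ 3 * X 2 - X 1 * X 2 ^ 2
    let f₄ : MvPolynomial (Fin 3) k :=
      -(X 0 ^ (r + 2) * X 1) + X 0 ^ r * X 2 ^ 2 + X 0 ^ 2 * X 1 * X 2 - X 2 ^ 3
    I = Ideal.span {f₁, f₂, f₃, f₄} ∧
      (∀ (s : ℕ) (g : Fin s → MvPolynomial (Fin 3) k),
        Ideal.span (Set.range g) = I → 4 ≤ s) ∧
      relType I = 3 := by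
  intro 𝔭n 𝔭m I f₁ f₂ f₃ f₄
  obtain ⟨ρ, rfl⟩ : ∃ ρ, r = ρ + 1 := ⟨r - 1, by omega⟩
  have hρ : 2 ≤ ρ := by omega
  have hI : I = Ideal.span (Set.range (idealGens k ρ)) := ker_inf_ker_eq_span_idealGens ρ
  have hgens : idealGens k ρ = ![f₁, f₂, f₃, f₄] := by
    funext i
    fin_cases i <;> simp [idealGens, f₁, f₂, f₃, f₄] <;> ring
  refine ⟨?_, fun s g hg => four_le_of_span_eq hρ (hg.trans hI), ?_⟩
  · rw [hI, hgens]
    simp only [Matrix.range_cons, Matrix.range_empty, Set.union_empty, Set.singleton_union]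
  · rw [hI]
    exact relType_span_idealGens hρ
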